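/- There is a constant C depending only on n such that for every f ∈ bmo(ℝⁿ) and every cube Q in ℝⁿ with ℓ(Q) < 1, the average of |f| over Q satisfies |f|_Q ≤ C log(2/ℓ(Q)) ‖f‖_{bmo(ℝⁿ)}. -/

import Mathlib

open MeasureTheory Metric Filter Topology

noncomputable section

/-- A closed axis-parallel cube in ℝⁿ: a closed ball in the sup norm with
positive radius (`half` = half the sidelength). -/
structure Cube (n : ℕ) where
  center : Fin n → ℝ
  half : ℝ
  half_pos : 0 < half

namespace Cube

variable {n : ℕ}

/-- The underlying set of a cube. -/
def toSet (Q : Cube n) : Set (Fin n → ℝ) := Metric.closedBall Q.center Q.half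

/-- The sidelength ℓ(Q). -/
def side (Q : Cube n) : ℝ := 2 * Q.half

/-- The mean f_Q of f over Q. -/
def avg (Q : Cube n) (f : (Fin n → ℝ) → ℝ) : ℝ := ⨍ x in Q.toSet, f x

/-- Mean oscillation of f over Q. -/
def osc (Q : Cube n) (f : (Fin n → ℝ) → ℝ) : ℝ := ⨍ x in Q.toSet, |f x - Q.avg f|

/-- The mean |f|_Q of |f| over Q. -/
def avgAbs (Q : Cube n) (f : (Fin n → ℝ) → ℝ) : ℝ := ⨍ x in Q.toSet, |f x|

/-- Distance from the cube to the origin. -/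
def distToOrigin (Q : Cube n) : ℝ := Metric.infDist (0 : Fin n → ℝ) Q.toSet

/-- The cube 2Q, concentric with Q and of twice the sidelength. -/
def double (Q : Cube n) : Cube n := ⟨Q.center, 2 * Q.half, mul_pos two_pos Q.half_pos⟩

end Cube

variable {n : ℕ}

/-- The modulus of mean oscillation ω_U(f,t): the supremum of the mean oscillation
of f over cubes Q ⊆ U of sidelength < t. -/
def omegaOn (U : Set (Fin n → ℝ)) (f : (Fin n → ℝ) → ℝ) (t : ℝ) : ℝ :=
  sSup {r | ∃ Q : Cube n, Q.toSet ⊆ U ∧ Q.side < t ∧ r = Q.osc f}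

/-- sup{ |f|_Q : Q ⊆ U, ℓ(Q) ≥ lam }. -/
def bigAvgSup (U : Set (Fin n → ℝ)) (lam : ℝ) (f : (Fin n → ℝ) → ℝ) : ℝ :=
  sSup {r | ∃ Q : Cube n, Q.toSet ⊆ U ∧ lam ≤ Q.side ∧ r = Q.avgAbs f}

/-- The nonhomogeneous norm ‖f‖_{bmo_lam(U)}. -/
def bmoNorm (U : Set (Fin n → ℝ)) (lam : ℝ) (f : (Fin n → ℝ) → ℝ) : ℝ :=
  omegaOn U f lam + bigAvgSup U lam f

/-- Membership in bmo_lam(U): integrable on every cube in U and finite norm. -/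
def MemBmo (U : Set (Fin n → ℝ)) (lam : ℝ) (f : (Fin n → ℝ) → ℝ) : Prop :=
  (∀ Q : Cube n, Q.toSet ⊆ U → IntegrableOn f Q.toSet) ∧
  BddAbove {r | ∃ Q : Cube n, Q.toSet ⊆ U ∧ Q.side < lam ∧ r = Q.osc f} ∧
  BddAbove {r | ∃ Q : Cube n, Q.toSet ⊆ U ∧ lam ≤ Q.side ∧ r = Q.avgAbs f}

/-- Sarason's vanishing mean oscillation condition: ω_U(f,t) → 0 as t → 0⁺. -/
def VanishSmallOsc (U : Set (Fin n → ℝ)) (f : (Fin n → ℝ) → ℝ) : Prop :=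
  Tendsto (fun t => omegaOn U f t) (nhdsWithin 0 (Set.Ioi 0)) (nhds 0)

/-- f is bounded on U. -/
def BoundedOn (U : Set (Fin n → ℝ)) (f : (Fin n → ℝ) → ℝ) : Prop :=
  ∃ M : ℝ, ∀ x ∈ U, |f x| ≤ M

/-- f is Lipschitz on U. -/
def LipschitzOn (U : Set (Fin n → ℝ)) (f : (Fin n → ℝ) → ℝ) : Prop :=
  ∃ K : NNReal, LipschitzOnWith K f U

/-- dist(supp f, ∂U) > 0. -/
def SuppAway (U : Set (Fin n → ℝ)) (f : (Fin n → ℝ) → ℝ) : Prop :=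
  ∃ d > 0, ∀ x ∈ Function.support f, ∀ y ∈ frontier U, d ≤ dist x y

/-- The nonhomogeneous Lipschitz norm ‖f‖_{Lip_b(U)} = ‖f‖_∞ + Lipschitz seminorm. -/
def lipbNorm (U : Set (Fin n → ℝ)) (f : (Fin n → ℝ) → ℝ) : ℝ :=
  sSup {r | ∃ x ∈ U, r = |f x|} +
  sSup {r | ∃ x ∈ U, ∃ y ∈ U, x ≠ y ∧ r = |f x - f y| / dist x y}

/-- U is a domain: a nonempty open connected subset of ℝⁿ. -/
def IsRealDomain (U : Set (Fin n → ℝ)) : Prop := IsOpen U ∧ IsConnected U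

/-- U is an (ε,δ)-domain. -/
def IsEpsDeltaDomain (U : Set (Fin n → ℝ)) (ε δ : ℝ) : Prop :=
  ∀ x ∈ U, ∀ y ∈ U, dist x y < δ →
    ∃ γ : ℝ → (Fin n → ℝ), ContinuousOn γ (Set.Icc 0 1) ∧ γ 0 = x ∧ γ 1 = y ∧
      (∀ t ∈ Set.Icc (0:ℝ) 1, γ t ∈ U) ∧
      eVariationOn γ (Set.Icc 0 1) ≤ ENNReal.ofReal (ε⁻¹ * dist x y) ∧
      ∀ t ∈ Set.Icc (0:ℝ) 1,
        ε * (dist (γ t) x * dist (γ t) y) / dist x y ≤ Metric.infDist (γ t) (frontier U)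

/-- The natural scale λ_{ε,δ} for an (ε,δ)-domain. -/
def lamED (n : ℕ) (ε δ : ℝ) : ℝ := ε ^ 2 * δ / (320 * n * (1 + Real.sqrt n * ε))

/-- d_Ω(x) = dist(x,∂Ω). -/
def distBd (U : Set (Fin n → ℝ)) (x : Fin n → ℝ) : ℝ := Metric.infDist x (frontier U)

/-- Ω̊_t = {x ∈ Ω : d_Ω(x) ≥ t}. -/
def innerPart (U : Set (Fin n → ℝ)) (t : ℝ) : Set (Fin n → ℝ) :=
  {x ∈ U | t ≤ distBd U x}

/-- f vanishes at infinity in the bmo_lam(U) sense. -/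
def VanishAtInfinity (U : Set (Fin n → ℝ)) (lam : ℝ) (f : (Fin n → ℝ) → ℝ) : Prop :=
  Tendsto (fun R => bmoNorm (U \ Metric.closedBall 0 R) lam f) atTop (nhds 0)

/-- f vanishes at the boundary in the bmo_lam(U) sense. -/
def VanishAtBoundary (U : Set (Fin n → ℝ)) (lam : ℝ) (f : (Fin n → ℝ) → ℝ) : Prop :=
  Tendsto (fun t => bmoNorm (U \ innerPart U t) lam f) (nhdsWithin 0 (Set.Ioi 0)) (nhds 0)

/-- f is in the bmo_lam(U)-closure of the continuous functions with compact support in U. -/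
def InCmoClosure (U : Set (Fin n → ℝ)) (lam : ℝ) (f : (Fin n → ℝ) → ℝ) : Prop :=
  ∃ g : ℕ → (Fin n → ℝ) → ℝ,
    (∀ j, Continuous (g j) ∧ HasCompactSupport (g j) ∧ tsupport (g j) ⊆ U) ∧
    Tendsto (fun j => bmoNorm U lam (f - g j)) atTop (nhds 0)

/-- The homogeneous BMO(ℝⁿ) seminorm: sup of mean oscillation over all cubes. -/
def bmoHNorm (f : (Fin n → ℝ) → ℝ) : ℝ := sSup {r | ∃ Q : Cube n, r = Q.osc f}

namespace Cube

theorem volume_real_toSet {n : ℕ} (Q : Cube n) : volume.real Q.toSet = Q.side ^ n := by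
  have h := Q.half_pos
  rw [Measure.real, toSet, Real.volume_pi_closedBall _ h.le, ENNReal.toReal_ofReal (by positivity),
    Fintype.card_fin, side]

theorem side_pos {n : ℕ} (Q : Cube n) : 0 < Q.side :=
  mul_pos two_pos Q.half_pos

theorem volume_toSet_ne_top {n : ℕ} (Q : Cube n) : volume Q.toSet ≠ ⊤ :=
  (isCompact_closedBall _ _).measure_lt_top.ne

theorem setAverage_toSet_eq {n : ℕ} (Q : Cube n) (g : (Fin n → ℝ) → ℝ) :
    ⨍ x in Q.toSet, g x = (Q.side ^ n)⁻¹ * ∫ x in Q.toSet, g x := by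
  rw [setAverage_eq, volume_real_toSet, smul_eq_mul]

theorem setAverage_mono {n : ℕ} (Q : Cube n) {g h : (Fin n → ℝ) → ℝ}
    (hg : IntegrableOn g Q.toSet) (hh : IntegrableOn h Q.toSet) (hgh : ∀ x, g x ≤ h x) :
    ⨍ x in Q.toSet, g x ≤ ⨍ x in Q.toSet, h x := by
  have := Q.side_pos
  rw [setAverage_toSet_eq, setAverage_toSet_eq]
  exact mul_le_mul_of_nonneg_left (integral_mono hg hh hgh) (by positivity)

theorem setAverage_add_const {n : ℕ} (Q : Cube n) {g : (Fin n → ℝ) → ℝ}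
    (hg : IntegrableOn g Q.toSet) (c : ℝ) :
    ⨍ x in Q.toSet, (g x + c) = (⨍ x in Q.toSet, g x) + c := by
  have := Q.side_pos
  rw [setAverage_toSet_eq, setAverage_toSet_eq,
    integral_add hg (integrableOn_const Q.volume_toSet_ne_top), setIntegral_const,
    volume_real_toSet, smul_eq_mul]
  field_simp

theorem abs_setAverage_le {n : ℕ} (Q : Cube n) (g : (Fin n → ℝ) → ℝ) :
    |⨍ x in Q.toSet, g x| ≤ ⨍ x in Q.toSet, |g x| := by
  have := Q.side_pos
  rw [setAverage_toSet_eq, setAverage_toSet_eq, abs_mul, abs_of_pos (a := (Q.side ^ n)⁻¹)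
    (by positivity)]
  exact mul_le_mul_of_nonneg_left abs_integral_le_integral_abs (by positivity)

theorem setAverage_nonneg {n : ℕ} (Q : Cube n) {g : (Fin n → ℝ) → ℝ} (hg : ∀ x, 0 ≤ g x) :
    0 ≤ ⨍ x in Q.toSet, g x := by
  have := Q.side_pos
  rw [setAverage_toSet_eq]
  exact mul_nonneg (by positivity) (integral_nonneg hg)

theorem side_double {n : ℕ} (Q : Cube n) : Q.double.side = 2 * Q.side := rfl

theorem toSet_subset_double {n : ℕ} (Q : Cube n) : Q.toSet ⊆ Q.double.toSet :=
  closedBall_subset_closedBall (by simp only [double]; linarith [Q.half_pos])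

theorem setAverage_le_double {n : ℕ} (Q : Cube n) {g : (Fin n → ℝ) → ℝ} (hg : ∀ x, 0 ≤ g x)
    (hi : IntegrableOn g Q.double.toSet) :
    ⨍ x in Q.toSet, g x ≤ 2 ^ n * ⨍ x in Q.double.toSet, g x := by
  have := Q.side_pos
  rw [setAverage_toSet_eq, setAverage_toSet_eq, side_double, mul_pow, mul_inv, ← mul_assoc,
    ← mul_assoc, mul_inv_cancel₀ (by positivity), one_mul]
  exact mul_le_mul_of_nonneg_left (setIntegral_mono_set hi (.of_forall hg)
    (.of_forall Q.toSet_subset_double)) (by positivity)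

theorem abs_avg_le_avgAbs {n : ℕ} (Q : Cube n) (f : (Fin n → ℝ) → ℝ) :
    |Q.avg f| ≤ Q.avgAbs f :=
  Q.abs_setAverage_le f

theorem integrableOn_sub_const {n : ℕ} (Q : Cube n) {f : (Fin n → ℝ) → ℝ}
    (hf : IntegrableOn f Q.toSet) (c : ℝ) : IntegrableOn (fun x => f x - c) Q.toSet :=
  hf.sub (integrableOn_const Q.volume_toSet_ne_top)

theorem avgAbs_le_osc_add_abs_avg {n : ℕ} (Q : Cube n) {f : (Fin n → ℝ) → ℝ}
    (hf : IntegrableOn f Q.toSet) : Q.avgAbs f ≤ Q.osc f + |Q.avg f| := by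
  have hi := (Q.integrableOn_sub_const hf (Q.avg f)).abs
  rw [osc, ← Q.setAverage_add_const hi]
  refine Q.setAverage_mono hf.abs (hi.add (integrableOn_const Q.volume_toSet_ne_top)) fun x => ?_
  simpa using abs_add_le (f x - Q.avg f) (Q.avg f)

theorem abs_avg_sub_avg_double_le {n : ℕ} (Q : Cube n) {f : (Fin n → ℝ) → ℝ}
    (hf : IntegrableOn f Q.double.toSet) :
    |Q.avg f - Q.double.avg f| ≤ 2 ^ n * Q.double.osc f := by
  have h1 := Q.setAverage_add_const (hf.mono_set Q.toSet_subset_double) (-Q.double.avg f)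
  simp only [← sub_eq_add_neg] at h1
  rw [avg, ← h1]
  exact (Q.abs_setAverage_le _).trans (Q.setAverage_le_double (fun _ => abs_nonneg _)
    (Q.double.integrableOn_sub_const hf _).abs)

end Cube

section

variable {n : ℕ} {f : (Fin n → ℝ) → ℝ}

theorem omegaOn_nonneg (U : Set (Fin n → ℝ)) (t : ℝ) : 0 ≤ omegaOn U f t := by
  refine Real.sSup_nonneg ?_
  rintro _ ⟨Q, -, -, rfl⟩
  exact Q.setAverage_nonneg fun _ => abs_nonneg _

theorem bigAvgSup_nonneg (U : Set (Fin n → ℝ)) (lam : ℝ) : 0 ≤ bigAvgSup U lam f := by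
  refine Real.sSup_nonneg ?_
  rintro _ ⟨Q, -, -, rfl⟩
  exact Q.setAverage_nonneg fun _ => abs_nonneg _

theorem MemBmo.osc_le {U : Set (Fin n → ℝ)} {lam : ℝ} (hf : MemBmo U lam f) {Q : Cube n}
    (hQU : Q.toSet ⊆ U) (hQ : Q.side < lam) : Q.osc f ≤ bmoNorm U lam f :=
  (le_csSup hf.2.1 ⟨Q, hQU, hQ, rfl⟩).trans (le_add_of_nonneg_right (bigAvgSup_nonneg U lam))

theorem MemBmo.avgAbs_le {U : Set (Fin n → ℝ)} {lam : ℝ} (hf : MemBmo U lam f) {Q : Cube n}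
    (hQU : Q.toSet ⊆ U) (hQ : lam ≤ Q.side) : Q.avgAbs f ≤ bmoNorm U lam f :=
  (le_csSup hf.2.2 ⟨Q, hQU, hQ, rfl⟩).trans (le_add_of_nonneg_left (omegaOn_nonneg U lam))

theorem bmoNorm_nonneg (U : Set (Fin n → ℝ)) (lam : ℝ) : 0 ≤ bmoNorm U lam f :=
  add_nonneg (omegaOn_nonneg U lam) (bigAvgSup_nonneg U lam)

theorem MemBmo.abs_avg_le {lam : ℝ} (hf : MemBmo Set.univ lam f) (k : ℕ) :
    ∀ Q : Cube n, lam ≤ 2 ^ k * Q.side →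
      |Q.avg f| ≤ (k + 1) * (2 ^ n * bmoNorm Set.univ lam f) := by
  have hN : 0 ≤ bmoNorm Set.univ lam f := bmoNorm_nonneg _ _
  have hpow : (1 : ℝ) ≤ 2 ^ n := one_le_pow₀ one_le_two
  induction k with
  | zero =>
    intro Q hQ
    have h := (Q.abs_avg_le_avgAbs f).trans (hf.avgAbs_le (Set.subset_univ _) (by simpa using hQ))
    simp only [Nat.cast_zero, zero_add, one_mul]
    nlinarith
  | succ k ih =>
    intro Q hQ
    have hi := hf.1 Q.double (Set.subset_univ _)
    rcases lt_or_ge Q.double.side lam with hlt | hge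
    · have h1 := ih Q.double (by rw [Q.side_double]; convert hQ using 1; ring)
      have h2 := (Q.abs_avg_sub_avg_double_le hi).trans
        (mul_le_mul_of_nonneg_left (hf.osc_le (Set.subset_univ _) hlt) (by positivity))
      have h3 := abs_sub_abs_le_abs_sub (Q.avg f) (Q.double.avg f)
      push_cast
      linarith
    · have h1 : Q.avgAbs f ≤ 2 ^ n * Q.double.avgAbs f :=
        Q.setAverage_le_double (fun _ => abs_nonneg _) hi.abs
      have h2 := h1.trans
        (mul_le_mul_of_nonneg_left (hf.avgAbs_le (Set.subset_univ _) hge) (by positivity))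
      have h3 : (0 : ℝ) ≤ (k + 1) * (2 ^ n * bmoNorm Set.univ lam f) := by positivity
      have h4 := Q.abs_avg_le_avgAbs f
      push_cast
      linarith

end

/-- Logarithmic estimate in bmo(ℝⁿ): there is C = C(n) such that for every f ∈ bmo(ℝⁿ)
and every cube Q with ℓ(Q) < 1, |f|_Q ≤ C log(2/ℓ(Q)) ‖f‖_{bmo(ℝⁿ)}. -/
theorem stmt8 (n : ℕ) (hn : 0 < n) :
    ∃ C : ℝ, 0 < C ∧ ∀ f : (Fin n → ℝ) → ℝ,
      MemBmo (Set.univ : Set (Fin n → ℝ)) 1 f →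
      ∀ Q : Cube n, Q.side < 1 →
        Q.avgAbs f ≤ C * Real.log (2 / Q.side) * bmoNorm Set.univ 1 f := by
  have hlog2 : 0 < Real.log 2 := Real.log_pos one_lt_two
  refine ⟨3 * 2 ^ n / Real.log 2, by positivity, fun f hf Q hQ => ?_⟩
  have hs := Q.side_pos
  set N := bmoNorm Set.univ 1 f
  have hN : 0 ≤ N := bmoNorm_nonneg _ _
  have hpow : (1 : ℝ) ≤ 2 ^ n := one_le_pow₀ one_le_two
  set L := Real.logb 2 (1 / Q.side)
  have hL : 0 ≤ L := Real.logb_nonneg one_lt_two (by rw [le_div_iff₀ hs]; linarith)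
  have hlog : Real.log (2 / Q.side) = Real.log 2 * (1 + L) := by
    have h : Real.log 2 * L = Real.log (1 / Q.side) := mul_div_cancel₀ _ hlog2.ne'
    rw [mul_add, mul_one, h, ← Real.log_mul two_ne_zero (by positivity), mul_one_div]
  set k := ⌈L⌉₊
  have hk : (k : ℝ) ≤ L + 1 := (Nat.ceil_lt_add_one hL).le
  have hside : 1 ≤ 2 ^ k * Q.side := by
    rw [← div_le_iff₀ hs, ← Real.rpow_natCast, ← Real.logb_le_iff_le_rpow one_lt_two (by positivity)]
    exact Nat.le_ceil L
  have h1 := hf.abs_avg_le k Q hside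
  have h2 := Q.avgAbs_le_osc_add_abs_avg (hf.1 Q (Set.subset_univ _))
  have h3 := hf.osc_le (Set.subset_univ _) hQ
  calc Q.avgAbs f ≤ (k + 2) * (2 ^ n * N) := by nlinarith
    _ ≤ (3 * (1 + L)) * (2 ^ n * N) := by gcongr; linarith
    _ = 3 * 2 ^ n / Real.log 2 * Real.log (2 / Q.side) * N := by
      rw [hlog]
      field_simp
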